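/- arXiv:2008.11581 — 2 statements merged into one kernel-verified Lean document; each statement's English description precedes it below -/
import Mathlib

section
/- Let E be a Polish space with Borel σ-field 𝓔, let P be a Markov kernel on E, and let ρ : E × E → [0, ∞) be lower semi-continuous and positive definite (ρ(x,y) = 0 iff x = y). Assume there exists M ∈ 𝓔 such that μ(M) > 0 for every invariant probability measure μ of P, and such that for every x, y ∈ M there exists α_{x,y} > 0 such that for every ε > 0 there exists a generalized coupling ξ^ε_{x,y} ∈ Ĉ(ℙ_x, ℙ_y) with ξ^ε_{x,y}( { (ξ, η) : limsup_{n→∞} (1/n) ∑_{i=0}^{n−1} 𝟙_{[0,ε]}(ρ(ξ_i, η_i)) ≥ α_{x,y} } ) > 0. Then P has at most one invariant probability measure. -/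
open MeasureTheory ProbabilityTheory Filter

/-- `μ` is an invariant probability measure of the Markov kernel `P`. -/
def IsInvariantMeasure {E : Type*} [MeasurableSpace E] (P : Kernel E E)
    (μ : Measure E) : Prop :=
  ∀ A : Set E, MeasurableSet A → μ A = ∫⁻ x, P x A ∂μ

/-- Prepend a point to a trajectory. -/
def consTraj {E : Type*} (x : E) (ω : ℕ → E) : ℕ → E :=
  fun n => Nat.casesOn n x ω

/-- `ℙP : E → Measure (ℕ → E)` is the family of laws of the Markov chain with
kernel `P`. -/
def IsChainLaw {E : Type*} [MeasurableSpace E] (P : Kernel E E)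
    (ℙP : E → Measure (ℕ → E)) : Prop :=
  (∀ x, IsProbabilityMeasure (ℙP x)) ∧
    ∀ x, ℙP x = (P x).bind (fun y => (ℙP y).map (consTraj x))

/-- `ξ` is a generalized coupling of `ℙx` and `ℙy`. -/
def IsGeneralizedCoupling {E : Type*} [MeasurableSpace E]
    (ξ : Measure ((ℕ → E) × (ℕ → E))) (ℙx ℙy : Measure (ℕ → E)) : Prop :=
  IsProbabilityMeasure ξ ∧ ξ.map Prod.fst ≪ ℙx ∧ ξ.map Prod.snd ≪ ℙy


open scoped ENNReal

namespace GenCoup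

set_option linter.unusedSectionVars false

variable {E : Type*} [MeasurableSpace E]

/-- Shift on trajectories. -/
def shift (ω : ℕ → E) : ℕ → E := fun n => ω (n + 1)

lemma measurable_shift : Measurable (shift : (ℕ → E) → ℕ → E) :=
  measurable_pi_iff.2 fun n => measurable_pi_apply (n + 1)

@[simp] lemma shift_consTraj (x : E) (ω : ℕ → E) : shift (consTraj x ω) = ω := rfl

lemma measurable_consTraj (x : E) : Measurable (consTraj x) := by
  refine measurable_pi_iff.2 fun n => ?_
  cases n with
  | zero => exact measurable_const
  | succ n => exact measurable_pi_apply n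

/-- Cylinder boxes. -/
def box (n : ℕ) (s : ℕ → Set E) : Set (ℕ → E) := {ω | ∀ i < n, ω i ∈ s i}

lemma measurableSet_box (n : ℕ) (s : ℕ → Set E) (hs : ∀ i, MeasurableSet (s i)) :
    MeasurableSet (box n s) := by
  have : box n s = ⋂ i, ⋂ (_ : i < n), (fun ω : ℕ → E => ω i) ⁻¹' s i := by
    ext ω; simp [box]
  rw [this]
  exact MeasurableSet.iInter fun i => MeasurableSet.iInter fun _ => measurable_pi_apply i (hs i)

/-- The collection of measurable boxes. -/
def boxes (E : Type*) [MeasurableSpace E] : Set (Set (ℕ → E)) :=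
  {C | ∃ n s, (∀ i, MeasurableSet (s i)) ∧ C = box n s}

lemma isPiSystem_boxes : IsPiSystem (boxes E) := by
  rintro _ ⟨n, s, hs, rfl⟩ _ ⟨m, t, ht, rfl⟩ -
  refine ⟨max n m, fun i => (if i < n then s i else Set.univ) ∩ (if i < m then t i else Set.univ),
    fun i => ?_, ?_⟩
  · refine MeasurableSet.inter ?_ ?_ <;> split_ifs <;> simp [hs, ht]
  · ext ω
    simp only [box, Set.mem_inter_iff, Set.mem_ofPred_eq]
    constructor
    · rintro ⟨h1, h2⟩ i -
      constructor
      · split_ifs with h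
        · exact h1 i h
        · trivial
      · split_ifs with h
        · exact h2 i h
        · trivial
    · intro h
      constructor
      · intro i hi
        have := (h i (lt_max_of_lt_left hi)).1
        rwa [if_pos hi] at this
      · intro i hi
        have := (h i (lt_max_of_lt_right hi)).2
        rwa [if_pos hi] at this

lemma generateFrom_boxes :
    (MeasurableSpace.pi : MeasurableSpace (ℕ → E)) = MeasurableSpace.generateFrom (boxes E) := by
  apply le_antisymm
  · refine iSup_le fun i => ?_
    rintro _ ⟨A, hA, rfl⟩
    apply MeasurableSpace.measurableSet_generateFrom
    refine ⟨i + 1, fun j => if j = i then A else Set.univ, fun j => ?_, ?_⟩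
    · dsimp only; split_ifs
      · exact hA
      · exact .univ
    · ext ω
      simp only [box, Set.mem_preimage, Set.mem_ofPred_eq]
      constructor
      · intro h j _
        split_ifs with hj
        · rw [hj]; exact h
        · trivial
      · intro h
        simpa using h i (Nat.lt_succ_self i)
  · apply MeasurableSpace.generateFrom_le
    rintro _ ⟨n, s, hs, rfl⟩
    exact measurableSet_box n s hs

lemma univ_mem_boxes : Set.univ ∈ boxes E :=
  ⟨0, fun _ => Set.univ, fun _ => .univ, by ext; simp [box]⟩

lemma consTraj_preimage_box (x : E) (n : ℕ) (s : ℕ → Set E) :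
    consTraj x ⁻¹' (box (n + 1) s) = {ω | x ∈ s 0 ∧ ω ∈ box n (fun i => s (i + 1))} := by
  ext ω
  simp only [box, Set.mem_preimage, Set.mem_ofPred_eq]
  constructor
  · intro h
    exact ⟨h 0 (Nat.succ_pos _), fun i hi => h (i + 1) (Nat.succ_lt_succ hi)⟩
  · rintro ⟨h0, h⟩ i hi
    cases i with
    | zero => exact h0
    | succ i => exact h i (Nat.lt_of_succ_lt_succ hi)

lemma chain_apply {P : Kernel E E} {Q : E → Measure (ℕ → E)} (h : IsChainLaw P Q) (x : E)
    {A : Set (ℕ → E)} (hA : MeasurableSet A) :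
    Q x A = ∫⁻ y, Q y (consTraj x ⁻¹' A) ∂(P x) := by
  have hae : AEMeasurable (fun y => (Q y).map (consTraj x)) (P x) := by
    by_contra hn
    have h2 := h.2 x
    rw [Measure.bind, Measure.map_of_not_aemeasurable hn, Measure.join_zero] at h2
    have := (h.1 x).measure_univ
    rw [h2] at this
    simp at this
  conv_lhs => rw [h.2 x]
  rw [Measure.bind_apply hA hae]
  congr 1
  ext y
  rw [Measure.map_apply (measurable_consTraj x) hA]

lemma chain_box {P : Kernel E E} {Q : E → Measure (ℕ → E)} (h : IsChainLaw P Q) (x : E)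
    (n : ℕ) (s : ℕ → Set E) (hs : ∀ i, MeasurableSet (s i)) :
    Q x (box (n + 1) s) =
      (s 0).indicator (fun x => ∫⁻ y, Q y (box n (fun i => s (i + 1))) ∂(P x)) x := by
  rw [chain_apply h x (measurableSet_box _ s hs)]
  simp_rw [consTraj_preimage_box]
  by_cases hx : x ∈ s 0 <;> simp [hx]

lemma chain_measurable {P : Kernel E E} {Q : E → Measure (ℕ → E)}
    (h : IsChainLaw P Q) : Measurable Q := by
  have := h.1
  refine Measurable.measure_of_isPiSystem_of_isProbabilityMeasure generateFrom_boxes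
    isPiSystem_boxes ?_
  rintro _ ⟨n, s, hs, rfl⟩
  induction n generalizing s with
  | zero =>
    have : box 0 s = Set.univ := by ext; simp [box]
    simp [this]
  | succ n ih =>
    simp_rw [chain_box h _ n s hs]
    exact ((ih _ fun i => hs (i + 1)).lintegral_kernel).indicator (hs 0)

/-- The chain law as a kernel. -/
noncomputable def chainKernel {P : Kernel E E} {Q : E → Measure (ℕ → E)}
    (h : IsChainLaw P Q) : Kernel E (ℕ → E) := ⟨Q, chain_measurable h⟩

lemma chainKernel_apply {P : Kernel E E} {Q : E → Measure (ℕ → E)}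
    (h : IsChainLaw P Q) (x : E) : chainKernel h x = Q x := rfl

instance {P : Kernel E E} {Q : E → Measure (ℕ → E)}
    (h : IsChainLaw P Q) : IsMarkovKernel (chainKernel h) := ⟨h.1⟩

/-- bounded harmonic functions are constant along the chain, a.e. -/
lemma harmonic_const {P : Kernel E E} [IsMarkovKernel P] {μ : Measure E} [IsFiniteMeasure μ]
    (hμ : μ.bind P = μ) {g : E → ℝ} (hg : Measurable g) (hg0 : ∀ x, 0 ≤ g x) (hg1 : ∀ x, g x ≤ 1)
    (hharm : ∀ x, ∫ y, g y ∂(P x) = g x) :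
    ∀ᵐ x ∂μ, ∀ᵐ y ∂(P x), g y = g x := by
  have hint : ∀ (m : Measure E) [IsFiniteMeasure m], Integrable g m := fun m _ =>
    Integrable.of_bound hg.aestronglyMeasurable 1
      (.of_forall fun x => by rw [Real.norm_eq_abs, abs_of_nonneg (hg0 x)]; exact hg1 x)
  have hint2 : ∀ (m : Measure E) [IsFiniteMeasure m], Integrable (fun x => g x ^ 2) m := fun m _ =>
    Integrable.of_bound (hg.pow_const 2).aestronglyMeasurable 1
      (.of_forall fun x => by
        rw [Real.norm_eq_abs, abs_of_nonneg (sq_nonneg _)]; exact pow_le_one₀ (hg0 x) (hg1 x))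
  have hint3 : ∀ x, Integrable (fun y => (g y - g x) ^ 2) (P x) := fun x => by
    have : (fun y => (g y - g x) ^ 2) = fun y => g y ^ 2 - 2 * g x * g y + g x ^ 2 := by
      ext y; ring
    rw [this]
    exact ((hint2 _).sub ((hint _).const_mul _)).add (integrable_const _)
  have hF : ∀ x, ∫ y, (g y - g x) ^ 2 ∂(P x) = ∫ y, g y ^ 2 ∂(P x) - g x ^ 2 := fun x => by
    have : (fun y => (g y - g x) ^ 2) = fun y => g y ^ 2 - 2 * g x * g y + g x ^ 2 := by
      ext y; ring
    have i1 : Integrable (fun y => g y ^ 2 - 2 * g x * g y) (P x) :=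
      (hint2 _).sub ((hint _).const_mul _)
    rw [this, integral_add i1 (integrable_const _),
      integral_sub (hint2 _) ((hint _).const_mul _), integral_const_mul, hharm]
    simp; ring
  have hI : Integrable (fun x => ∫ y, g y ^ 2 ∂(P x)) μ := by
    refine Integrable.of_bound (C := 1)
      (StronglyMeasurable.integral_kernel (hg.pow_const 2).stronglyMeasurable).aestronglyMeasurable
      (.of_forall fun x => ?_)
    rw [Real.norm_eq_abs, abs_of_nonneg (integral_nonneg fun y => sq_nonneg _)]
    calc ∫ y, g y ^ 2 ∂(P x) ≤ ∫ y, 1 ∂(P x) :=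
          integral_mono (hint2 _) (integrable_const _) fun y => pow_le_one₀ (hg0 y) (hg1 y)
      _ = 1 := by simp
  have hz : ∫ x, ∫ y, (g y - g x) ^ 2 ∂(P x) ∂μ = 0 := by
    simp_rw [hF]
    have hc : (P ∘ₖ Kernel.const Unit μ) () = μ := by
      rw [Kernel.comp_apply, Kernel.const_apply, hμ]
    have h1 := Kernel.integral_comp (η := P) (κ := Kernel.const Unit μ) (a := ())
      (f := fun x => g x ^ 2) (by rw [hc]; exact hint2 μ)
    rw [hc, Kernel.const_apply] at h1
    rw [integral_sub hI (hint2 μ), ← h1, sub_self]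
  rw [integral_eq_zero_iff_of_nonneg (fun x => integral_nonneg fun y => sq_nonneg _)
    (by simp_rw [hF]; exact hI.sub (hint2 μ))] at hz
  filter_upwards [hz] with x hx
  have hx' : ∫ y, (g y - g x) ^ 2 ∂(P x) = 0 := hx
  rw [integral_eq_zero_iff_of_nonneg (fun y => sq_nonneg _) (hint3 x)] at hx'
  filter_upwards [hx'] with y hy
  have : (g y - g x) ^ 2 = 0 := hy
  nlinarith [pow_eq_zero_iff (n := 2) (by norm_num) |>.1 this]

/-- zero-one law for invariant events -/
lemma zero_one {P : Kernel E E} [IsMarkovKernel P] {Q : E → Measure (ℕ → E)}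
    (h : IsChainLaw P Q) {μ : Measure E} [IsFiniteMeasure μ]
    (hμ : μ.bind P = μ) {G : Set (ℕ → E)} (hG : MeasurableSet G)
    (hinv : ∀ x ω, consTraj x ω ∈ G ↔ ω ∈ G) :
    ∀ᵐ x ∂μ, Q x G = 0 ∨ Q x G = 1 := by
  have hp := h.1
  have hQ := chain_measurable h
  have hhm : Measurable fun x => Q x G := (Measure.measurable_coe hG).comp hQ
  have hpre : ∀ x, consTraj x ⁻¹' G = G := fun x => by ext ω; exact hinv x ω
  have hharm : ∀ x, ∫⁻ y, Q y G ∂(P x) = Q x G := fun x => by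
    rw [chain_apply h x hG, hpre]
  have hle : ∀ x, Q x G ≤ 1 := fun x => prob_le_one
  have hne : ∀ x, Q x G ≠ ∞ := fun x => measure_ne_top _ _
  have hconst : ∀ᵐ x ∂μ, ∀ᵐ y ∂(P x), Q y G = Q x G := by
    have := harmonic_const hμ (g := fun x => (Q x G).toReal) hhm.ennreal_toReal
      (fun x => ENNReal.toReal_nonneg)
      (fun x => ENNReal.toReal_le_of_le_ofReal zero_le_one (by simpa using hle x))
      (fun x => by
        rw [integral_toReal hhm.aemeasurable (.of_forall fun y => (hne y).lt_top), hharm])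
    filter_upwards [this] with x hx
    filter_upwards [hx] with y hy
    exact (ENNReal.toReal_eq_toReal_iff' (hne y) (hne x)).1 hy
  have hbox : ∀ (n : ℕ) (s : ℕ → Set E), (∀ i, MeasurableSet (s i)) →
      ∀ᵐ x ∂μ, Q x (box n s ∩ G) = Q x G * Q x (box n s) := by
    intro n
    induction n with
    | zero =>
      intro s hs
      have : box 0 s = Set.univ := by ext; simp [box]
      simp [this]
    | succ n ih =>
      intro s hs
      have h1 := ih (fun i => s (i + 1)) (fun i => hs (i + 1))
      rw [← hμ] at h1
      have h2 := Measure.ae_ae_of_ae_bind P.aemeasurable h1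
      filter_upwards [h2, hconst] with x hx1 hx2
      rw [chain_box h x n s hs, chain_apply h x ((measurableSet_box _ s hs).inter hG)]
      simp_rw [Set.preimage_inter, hpre, consTraj_preimage_box]
      by_cases hx : x ∈ s 0
      · simp only [hx, true_and, Set.ofPred_mem_eq, Set.indicator_of_mem]
        rw [← lintegral_const_mul]
        · apply lintegral_congr_ae
          filter_upwards [hx1, hx2] with y hy1 hy2
          rw [hy1, hy2]
        · exact (Measure.measurable_coe (measurableSet_box _ _ fun i => hs (i + 1))).comp hQ
      · simp [hx]
  have hmm : ∀ C : Set (ℕ → E), MeasurableSet C → Measurable fun x => Q x C := fun C hC =>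
    (Measure.measurable_coe hC).comp hQ
  have hkey : (μ.bind Q).restrict G = (μ.withDensity fun x => Q x G).bind Q := by
    have fin1 : IsFiniteMeasure (μ.bind Q) := by
      constructor
      rw [Measure.bind_apply .univ hQ.aemeasurable]
      simp
    refine ext_of_generate_finite (boxes E) generateFrom_boxes isPiSystem_boxes ?_ ?_
    all_goals
      have aux : ∀ C ∈ boxes E, ((μ.bind Q).restrict G) C =
          ((μ.withDensity fun x => Q x G).bind Q) C := by
        rintro _ ⟨n, s, hs, rfl⟩
        have hm := measurableSet_box n s hs
        rw [Measure.restrict_apply hm, Measure.bind_apply (hm.inter hG) hQ.aemeasurable,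
          Measure.bind_apply hm hQ.aemeasurable,
          lintegral_withDensity_eq_lintegral_mul _ hhm (hmm _ hm)]
        exact lintegral_congr_ae (hbox n s hs)
    · exact aux
    · exact aux _ univ_mem_boxes
  have hint : ∫⁻ x, Q x G ∂μ = ∫⁻ x, Q x G * Q x G ∂μ := by
    have := congrArg (fun m => m G) hkey
    simp only [Measure.restrict_apply hG, Set.inter_self] at this
    rw [Measure.bind_apply hG hQ.aemeasurable, Measure.bind_apply hG hQ.aemeasurable,
      lintegral_withDensity_eq_lintegral_mul _ hhm hhm] at this
    exact this
  have hfin : ∫⁻ x, Q x G * Q x G ∂μ ≠ ∞ := by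
    rw [← hint]
    refine ne_top_of_le_ne_top (measure_ne_top μ Set.univ) ?_
    calc ∫⁻ x, Q x G ∂μ ≤ ∫⁻ x, 1 ∂μ := lintegral_mono hle
      _ = _ := by simp
  have hae := ae_eq_of_ae_le_of_lintegral_le (μ := μ) (f := fun x => Q x G * Q x G)
    (g := fun x => Q x G) (.of_forall fun x => mul_le_of_le_one_left' (hle x)) hfin
    hhm.aemeasurable hint.le
  filter_upwards [hae] with x hx
  by_cases h0 : Q x G = 0
  · exact Or.inl h0
  · right
    have hx : Q x G * Q x G = Q x G := hx
    have := (ENNReal.mul_right_inj h0 (hne x) (b := Q x G) (c := 1)).1 (by rw [hx, mul_one])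
    exact this

end GenCoup

namespace GenCoup

set_option linter.unusedSectionVars false

section Maximal

variable {Ω : Type*} [MeasurableSpace Ω]

/-- Running maximum of Birkhoff sums. -/
noncomputable def mx (f : Ω → ℝ) (T : Ω → Ω) : ℕ → Ω → ℝ
  | 0 => fun _ => 0
  | N + 1 => fun x => max 0 (f x + mx f T N (T x))

lemma mx_nonneg (f : Ω → ℝ) (T : Ω → Ω) (N : ℕ) (x : Ω) : 0 ≤ mx f T N x := by
  cases N with
  | zero => exact le_rfl
  | succ N => exact le_max_left _ _

lemma mx_mono (f : Ω → ℝ) (T : Ω → Ω) (N : ℕ) (x : Ω) : mx f T N x ≤ mx f T (N + 1) x := by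
  induction N generalizing x with
  | zero => exact mx_nonneg f T 1 x
  | succ N ih => exact max_le_max le_rfl (by linarith [ih (T x)])

lemma mx_le {f : Ω → ℝ} (T : Ω → Ω) (hf : ∀ x, f x ≤ 1) (N : ℕ) (x : Ω) : mx f T N x ≤ N := by
  induction N generalizing x with
  | zero => simp [mx]
  | succ N ih =>
    refine max_le (by positivity) ?_
    push_cast
    linarith [ih (T x), hf x]

lemma mx_measurable {f : Ω → ℝ} {T : Ω → Ω} (hf : Measurable f) (hT : Measurable T) (N : ℕ) :
    Measurable (mx f T N) := by
  induction N with
  | zero => exact measurable_const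
  | succ N ih => exact measurable_const.max (hf.add (ih.comp hT))

lemma birkhoffSum_le_mx (f : Ω → ℝ) (T : Ω → Ω) (N : ℕ) (x : Ω) :
    birkhoffSum T f N x ≤ mx f T N x := by
  induction N generalizing x with
  | zero => simp [mx]
  | succ N ih =>
    rw [birkhoffSum_succ']
    exact (add_le_add le_rfl (ih (T x))).trans (le_max_right _ _)

lemma mx_integrable {f : Ω → ℝ} {T : Ω → Ω} (hf : Measurable f) (hT : Measurable T)
    (hf1 : ∀ x, f x ≤ 1) (m : Measure Ω) [IsFiniteMeasure m] (N : ℕ) :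
    Integrable (mx f T N) m :=
  Integrable.of_bound (mx_measurable hf hT N).aestronglyMeasurable N
    (.of_forall fun x => by
      rw [Real.norm_eq_abs, abs_of_nonneg (mx_nonneg f T N x)]; exact mx_le T hf1 N x)

lemma maximal {m : Measure Ω} [IsFiniteMeasure m] {T : Ω → Ω} (hT : MeasurePreserving T m m)
    {A : Set Ω} (hA : MeasurableSet A) {c : ℝ} (hc : 0 < c) (N : ℕ) :
    c * m.real {x | 0 < mx (fun x => A.indicator 1 x - c) T N x} ≤ m.real A := by
  set f : Ω → ℝ := fun x => A.indicator 1 x - c with hfdef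
  have hfm : Measurable f := (measurable_one.indicator hA).sub_const c
  have hf1 : ∀ x, f x ≤ 1 := fun x => by
    have h1 : A.indicator (1 : Ω → ℝ) x ≤ 1 := Set.indicator_le_self' (by simp) x
    simp only [hfdef]; linarith
  cases N with
  | zero => simp [mx]
  | succ N =>
  set S : Set Ω := {x | 0 < mx f T (N + 1) x} with hS
  have hSm : MeasurableSet S :=
    measurableSet_lt measurable_const (mx_measurable hfm hT.measurable (N + 1))
  have i1 := mx_integrable hfm hT.measurable hf1 m (N + 1)
  have i2 := mx_integrable hfm hT.measurable hf1 m N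
  have i2' : Integrable (fun x => mx f T N (T x)) m := hT.integrable_comp_of_integrable i2
  have iA : Integrable (A.indicator (1 : Ω → ℝ)) m :=
    (integrable_const (1 : ℝ)).indicator hA
  have iS : Integrable (S.indicator (1 : Ω → ℝ)) m :=
    (integrable_const (1 : ℝ)).indicator hSm
  have hpt : ∀ x, mx f T (N + 1) x - mx f T N (T x) ≤
      A.indicator (1 : Ω → ℝ) x - c * S.indicator (1 : Ω → ℝ) x := by
    intro x
    by_cases hx : x ∈ S
    · have hx' : 0 < mx f T (N + 1) x := hx
      have he : mx f T (N + 1) x = f x + mx f T N (T x) := by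
        have hd : mx f T (N + 1) x = max 0 (f x + mx f T N (T x)) := rfl
        rw [hd] at hx' ⊢
        rcases lt_max_iff.1 hx' with h | h
        · exact absurd h (lt_irrefl _)
        · exact max_eq_right h.le
      rw [he, Set.indicator_of_mem hx]
      simp [hfdef]
    · have hx' : mx f T (N + 1) x = 0 :=
        le_antisymm (not_lt.1 hx) (mx_nonneg _ _ _ _)
      rw [hx', Set.indicator_of_notMem hx]
      have h1 := mx_nonneg f T N (T x)
      have h2 : 0 ≤ A.indicator (1 : Ω → ℝ) x := Set.indicator_nonneg (fun _ _ => zero_le_one) x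
      simp only [mul_zero, sub_zero]
      linarith
  have hI := integral_mono (i1.sub i2') (iA.sub (iS.const_mul c)) hpt
  have e1 : ∫ x, mx f T N (T x) ∂m = ∫ x, mx f T N x ∂m := by
    conv_rhs => rw [← hT.map_eq]
    rw [integral_map hT.measurable.aemeasurable
      (mx_measurable hfm hT.measurable N).aestronglyMeasurable]
  have e2 : ∫ x, mx f T N x ∂m ≤ ∫ x, mx f T (N + 1) x ∂m :=
    integral_mono i2 i1 (mx_mono f T N)
  have l : ∫ x, (mx f T (N + 1) - fun x => mx f T N (T x)) x ∂m =
      ∫ x, mx f T (N + 1) x ∂m - ∫ x, mx f T N (T x) ∂m := integral_sub i1 i2'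
  have r : ∫ x, (A.indicator (1 : Ω → ℝ) - fun x => c * S.indicator (1 : Ω → ℝ) x) x ∂m =
      m.real A - c * m.real S := by
    have := integral_sub iA (iS.const_mul c)
    rw [integral_const_mul, integral_indicator_one hA, integral_indicator_one hSm] at this
    exact this
  have hI' : ∫ x, mx f T (N + 1) x ∂m - ∫ x, mx f T N (T x) ∂m ≤ m.real A - c * m.real S := by
    rw [← l, ← r]; exact hI
  linarith

end Maximal

variable {E : Type*} [MeasurableSpace E]

/-- Event that `∑ (1_B(ω_i) - c)` is unbounded above. -/
def bad (B : Set E) (c : ℝ) : Set (ℕ → E) :=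
  {ω | ∀ k : ℕ, ∃ n : ℕ, (k : ℝ) < ∑ i ∈ Finset.range n, (B.indicator 1 (ω i) - c)}

lemma measurableSet_bad {B : Set E} (hB : MeasurableSet B) (c : ℝ) : MeasurableSet (bad B c) := by
  have : bad B c = ⋂ k : ℕ, ⋃ n : ℕ,
      {ω : ℕ → E | (k : ℝ) < ∑ i ∈ Finset.range n, (B.indicator 1 (ω i) - c)} := by
    ext ω; simp [bad]
  rw [this]
  refine MeasurableSet.iInter fun k => MeasurableSet.iUnion fun n =>
    measurableSet_lt measurable_const ?_
  refine Finset.measurable_sum _ fun i _ => ?_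
  exact ((measurable_one.indicator hB).comp (measurable_pi_apply i)).sub_const c

lemma sum_consTraj (B : Set E) (c : ℝ) (x : E) (ω : ℕ → E) (n : ℕ) :
    ∑ i ∈ Finset.range (n + 1), (B.indicator (1 : E → ℝ) (consTraj x ω i) - c) =
      (∑ i ∈ Finset.range n, (B.indicator (1 : E → ℝ) (ω i) - c)) + (B.indicator 1 x - c) := by
  rw [Finset.sum_range_succ']; rfl

lemma bad_inv {B : Set E} {c : ℝ} (hc : 0 < c) (x : E) (ω : ℕ → E) :
    consTraj x ω ∈ bad B c ↔ ω ∈ bad B c := by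
  have h0 : 0 ≤ B.indicator (1 : E → ℝ) x := Set.indicator_nonneg (fun _ _ => zero_le_one) x
  have h1 : B.indicator (1 : E → ℝ) x ≤ 1 := Set.indicator_le_self' (by simp) x
  constructor
  · intro h k
    obtain ⟨n, hn⟩ := h (k + 1)
    cases n with
    | zero =>
      push_cast at hn
      simp only [Finset.range_zero, Finset.sum_empty] at hn
      have : (0 : ℝ) ≤ k := k.cast_nonneg
      linarith
    | succ n =>
      rw [sum_consTraj] at hn
      push_cast at hn
      exact ⟨n, by linarith⟩
  · intro h k
    obtain ⟨j, hj⟩ := exists_nat_ge c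
    obtain ⟨n, hn⟩ := h (k + j)
    refine ⟨n + 1, ?_⟩
    rw [sum_consTraj]
    push_cast at hn
    linarith

lemma shift_iterate (n : ℕ) (ω : ℕ → E) : (shift^[n] ω) 0 = ω n := by
  induction n generalizing ω with
  | zero => rfl
  | succ n ih => rw [Function.iterate_succ_apply, ih]; rfl

lemma bad_measure_le {P : Kernel E E} [IsMarkovKernel P] {Q : E → Measure (ℕ → E)}
    (h : IsChainLaw P Q) {μ : Measure E} [IsFiniteMeasure μ]
    (hμ : μ.bind P = μ) {B : Set E} (hB : MeasurableSet B) {c : ℝ} (hc : 0 < c) :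
    ∫⁻ x, Q x (bad B c) ∂μ ≤ ENNReal.ofReal c⁻¹ * μ B := by
  have hp := h.1
  have hQ := chain_measurable h
  have hmm : ∀ C : Set (ℕ → E), MeasurableSet C → Measurable fun x => Q x C := fun C hC =>
    (Measure.measurable_coe hC).comp hQ
  have happ : ∀ C : Set (ℕ → E), MeasurableSet C → (μ.bind Q) C = ∫⁻ x, Q x C ∂μ := fun C hC =>
    Measure.bind_apply hC hQ.aemeasurable
  have fin1 : IsFiniteMeasure (μ.bind Q) := by
    constructor
    rw [happ _ .univ]
    simp
  have hT : MeasurePreserving (shift : (ℕ → E) → ℕ → E) (μ.bind Q) (μ.bind Q) := by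
    refine ⟨measurable_shift, ?_⟩
    ext C hC
    rw [Measure.map_apply measurable_shift hC, happ _ (measurable_shift hC), happ _ hC]
    conv_rhs => rw [← hμ]
    rw [Measure.lintegral_bind P.aemeasurable (hmm C hC).aemeasurable]
    congr 1
    ext x
    rw [chain_apply h x (measurable_shift hC)]
    rfl
  set A : Set (ℕ → E) := (fun ω => ω 0) ⁻¹' B with hAdef
  have hA : MeasurableSet A := measurable_pi_apply 0 hB
  have hAB : (μ.bind Q) A = μ B := by
    rw [happ A hA]
    have : ∀ x, Q x A = B.indicator 1 x := by
      intro x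
      rw [chain_apply h x hA]
      have : consTraj x ⁻¹' A = {ω | x ∈ B} := rfl
      by_cases hx : x ∈ B <;> simp [this, hx]
    simp_rw [this]
    exact lintegral_indicator_one hB
  set f : (ℕ → E) → ℝ := fun ω => A.indicator 1 ω - c with hf
  have hsub : bad B c ⊆ ⋃ N : ℕ, {ω | 0 < mx f shift N ω} := by
    intro ω hω
    obtain ⟨n, hn⟩ := hω 0
    refine Set.mem_iUnion.2 ⟨n, ?_⟩
    have := birkhoffSum_le_mx f shift n ω
    refine lt_of_lt_of_le ?_ this
    rw [birkhoffSum]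
    have e : ∀ i, f (shift^[i] ω) = B.indicator 1 (ω i) - c := fun i => by
      have : A.indicator (1 : (ℕ → E) → ℝ) (shift^[i] ω) = B.indicator 1 (shift^[i] ω 0) := rfl
      simp only [hf, this, shift_iterate]
    simp_rw [e]
    simpa using hn
  rw [← happ _ (measurableSet_bad hB c), ← hAB]
  refine (measure_mono hsub).trans ?_
  have hmono : Monotone fun N : ℕ => {ω | 0 < mx f shift N ω} :=
    monotone_nat_of_le_succ fun N ω hω => lt_of_lt_of_le hω (mx_mono f shift N ω)
  rw [hmono.measure_iUnion]
  refine iSup_le fun N => ?_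
  have := maximal hT hA hc N
  rw [← ENNReal.ofReal_toReal (measure_ne_top (μ.bind Q) A),
    ← ENNReal.ofReal_toReal (measure_ne_top (μ.bind Q) {ω | 0 < mx f shift N ω}),
    ← ENNReal.ofReal_mul (by positivity)]
  apply ENNReal.ofReal_le_ofReal
  rw [inv_mul_eq_div, le_div_iff₀' hc]
  exact this

lemma bad_key {P : Kernel E E} [IsMarkovKernel P] {Q : E → Measure (ℕ → E)}
    (h : IsChainLaw P Q) {μ : Measure E} [IsFiniteMeasure μ]
    (hμ : μ.bind P = μ) {B : Set E} (hB : MeasurableSet B) {c : ℝ} (hc : 0 < c) :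
    μ {x | Q x (bad B c) ≠ 0} ≤ ENNReal.ofReal c⁻¹ * μ B := by
  refine le_trans ?_ (bad_measure_le h hμ hB hc)
  have hQ := chain_measurable h
  have hm : Measurable fun x => Q x (bad B c) :=
    (Measure.measurable_coe (measurableSet_bad hB c)).comp hQ
  have hS : MeasurableSet {x | Q x (bad B c) ≠ 0} := (hm (measurableSet_singleton 0)).compl
  rw [← lintegral_indicator_one hS]
  apply lintegral_mono_ae
  filter_upwards [zero_one h hμ (measurableSet_bad hB c) (bad_inv hc)] with x hx
  by_cases hx0 : Q x (bad B c) = 0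
  · simp [hx0]
  · rw [hx.resolve_left hx0]
    exact Set.indicator_le_self' (by simp) x

/-- Along a summable sequence of sets, the bad events are eventually null. -/
lemma bad_eventually {P : Kernel E E} [IsMarkovKernel P] {Q : E → Measure (ℕ → E)}
    (h : IsChainLaw P Q) {μ : Measure E} [IsFiniteMeasure μ]
    (hμ : μ.bind P = μ) {B : ℕ → Set E} (hB : ∀ n, MeasurableSet (B n))
    (hs : ∑' n, μ (B n) ≠ ∞) :
    ∀ᵐ x ∂μ, ∀ k : ℕ, ∀ᶠ n in atTop, Q x (bad (B n) (1 / ((k : ℝ) + 1))) = 0 := by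
  rw [ae_all_iff]
  intro k
  have hc : (0 : ℝ) < 1 / ((k : ℝ) + 1) := by positivity
  have := ae_eventually_notMem (μ := μ)
    (s := fun n => {x | Q x (bad (B n) (1 / ((k : ℝ) + 1))) ≠ 0}) ?_
  · filter_upwards [this] with x hx
    filter_upwards [hx] with n hn
    by_contra h0
    exact hn h0
  · refine ne_top_of_le_ne_top ?_ (ENNReal.tsum_le_tsum fun n => bad_key h hμ (hB n) hc)
    rw [ENNReal.tsum_mul_left]
    exact ENNReal.mul_ne_top ENNReal.ofReal_ne_top hs

end GenCoup

namespace GenCoup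

variable {E : Type*} [MeasurableSpace E]

lemma invariant_iff {P : Kernel E E} {μ : Measure E} :
    IsInvariantMeasure P μ ↔ μ.bind P = μ := by
  constructor
  · intro h
    ext A hA
    rw [Measure.bind_apply hA P.aemeasurable, ← h A hA]
  · intro h A hA
    conv_lhs => rw [← h]
    rw [Measure.bind_apply hA P.aemeasurable]

lemma bind_add (P : Kernel E E) (μ ν : Measure E) : (μ + ν).bind P = μ.bind P + ν.bind P := by
  ext A hA
  rw [Measure.add_apply, Measure.bind_apply hA P.aemeasurable, Measure.bind_apply hA P.aemeasurable,
    Measure.bind_apply hA P.aemeasurable, lintegral_add_measure]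

lemma bind_mono (P : Kernel E E) {μ ν : Measure E} (h : μ ≤ ν) : μ.bind P ≤ ν.bind P := by
  refine Measure.le_iff.2 fun A hA => ?_
  rw [Measure.bind_apply hA P.aemeasurable, Measure.bind_apply hA P.aemeasurable]
  exact lintegral_mono' h le_rfl

lemma bind_univ (P : Kernel E E) [IsMarkovKernel P] (μ : Measure E) :
    μ.bind P Set.univ = μ Set.univ := by
  rw [Measure.bind_apply .univ P.aemeasurable]; simp

lemma add_right_cancel_measure {a b k : Measure E} [IsFiniteMeasure k] (h : a + k = b + k) :
    a = b := by
  ext A hA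
  have := congrArg (fun m => m A) h
  simp only [Measure.add_apply] at this
  exact (ENNReal.add_left_inj (measure_ne_top k A)).1 this

lemma inf_invariant {P : Kernel E E} [IsMarkovKernel P] {μ ν : Measure E} [IsFiniteMeasure μ]
    [IsFiniteMeasure ν] (hμ : μ.bind P = μ) (hν : ν.bind P = ν) :
    (μ ⊓ ν).bind P = μ ⊓ ν := by
  have : IsFiniteMeasure (μ ⊓ ν) := isFiniteMeasure_of_le μ inf_le_left
  have h1 : (μ ⊓ ν).bind P ≤ μ ⊓ ν := le_inf
    ((bind_mono P inf_le_left).trans hμ.le) ((bind_mono P inf_le_right).trans hν.le)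
  have : IsFiniteMeasure ((μ ⊓ ν).bind P) := isFiniteMeasure_of_le _ h1
  exact Measure.eq_of_le_of_measure_univ_eq h1 (bind_univ P _)

lemma sub_invariant {P : Kernel E E} [IsMarkovKernel P] {μ κ : Measure E} [IsFiniteMeasure μ]
    (hκμ : κ ≤ μ) (hμ : μ.bind P = μ) (hκ : κ.bind P = κ) :
    (μ - κ).bind P = μ - κ := by
  have : IsFiniteMeasure κ := isFiniteMeasure_of_le μ hκμ
  apply add_right_cancel_measure (k := κ)
  rw [Measure.sub_add_cancel_of_le hκμ]
  conv_lhs => rw [← hκ, hκ]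
  have := bind_add P (μ - κ) κ
  rw [Measure.sub_add_cancel_of_le hκμ, hμ, hκ] at this
  exact this.symm

lemma sub_inf_singular {μ ν : Measure E} [IsFiniteMeasure μ] [IsFiniteMeasure ν] :
    (μ - μ ⊓ ν) ⟂ₘ (ν - μ ⊓ ν) := by
  have : IsFiniteMeasure (μ ⊓ ν) := isFiniteMeasure_of_le μ inf_le_left
  apply Measure.mutuallySingular_of_disjoint
  rw [disjoint_iff_inf_le]
  set d := (μ - μ ⊓ ν) ⊓ (ν - μ ⊓ ν) with hd
  have h1 : d + μ ⊓ ν ≤ μ :=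
    (add_le_add_left (inf_le_left : d ≤ _) _).trans (Measure.sub_add_cancel_of_le inf_le_left).le
  have h2 : d + μ ⊓ ν ≤ ν :=
    (add_le_add_left (inf_le_right : d ≤ _) _).trans (Measure.sub_add_cancel_of_le inf_le_right).le
  have h3 : d + μ ⊓ ν ≤ μ ⊓ ν := le_inf h1 h2
  refine Measure.le_iff.2 fun A hA => ?_
  have h4 := Measure.le_iff.1 h3 A hA
  rw [Measure.add_apply] at h4
  have h5 : d A + (μ ⊓ ν) A ≤ 0 + (μ ⊓ ν) A := by rwa [zero_add]
  exact (ENNReal.add_le_add_iff_right (measure_ne_top (μ ⊓ ν) A)).1 h5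

lemma smul_invariant {P : Kernel E E} {μ : Measure E} (hμ : μ.bind P = μ) (c : ℝ≥0∞) :
    IsInvariantMeasure P (c • μ) := by
  intro A hA
  rw [lintegral_smul_measure, Measure.smul_apply, ← (invariant_iff.2 hμ) A hA]

lemma pos_of_ne_zero {P : Kernel E E} {M : Set E}
    (hMpos : ∀ μ : Measure E, IsProbabilityMeasure μ → IsInvariantMeasure P μ → 0 < μ M)
    {μ : Measure E} [IsFiniteMeasure μ] (hμ : μ.bind P = μ) (h0 : μ ≠ 0) : μ M ≠ 0 := by
  intro h
  have : NeZero μ := ⟨h0⟩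
  have := hMpos ((μ Set.univ)⁻¹ • μ) inferInstance (smul_invariant hμ _)
  simp [h] at this

lemma compacts [TopologicalSpace E] [PolishSpace E] [BorelSpace E]
    {μ : Measure E} [IsFiniteMeasure μ] {A : Set E} (hA : MeasurableSet A) (h0 : μ Aᶜ = 0) :
    ∃ K : ℕ → Set E, (∀ n, K n ⊆ A) ∧ (∀ n, IsCompact (K n)) ∧ ∑' n, μ (K n)ᶜ ≠ ∞ := by
  have hpos : ∀ n : ℕ, ((2 : ℝ≥0∞)⁻¹ ^ n) ≠ 0 := fun n => by simp
  have : ∀ n : ℕ, ∃ K ⊆ A, IsCompact K ∧ μ (A \ K) < (2 : ℝ≥0∞)⁻¹ ^ n := fun n =>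
    hA.exists_isCompact_sdiff_lt (measure_ne_top μ A) (hpos n)
  choose K hKA hK hKμ using this
  refine ⟨K, hKA, hK, ?_⟩
  refine ne_top_of_le_ne_top ?_ (ENNReal.tsum_le_tsum (g := fun n => (2 : ℝ≥0∞)⁻¹ ^ n) fun n => ?_)
  · rw [ENNReal.tsum_geometric]; simp
  · calc μ (K n)ᶜ ≤ μ (A \ K n ∪ Aᶜ) := measure_mono fun x hx => by
          by_cases h : x ∈ A
          · exact Or.inl ⟨h, hx⟩
          · exact Or.inr h
      _ ≤ μ (A \ K n) + μ Aᶜ := measure_union_le _ _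
      _ ≤ _ := by rw [h0, add_zero]; exact (hKμ n).le

lemma exists_eps [TopologicalSpace E] {ρ : E → E → ℝ}
    (hρlsc : LowerSemicontinuous (fun p : E × E => ρ p.1 p.2))
    (hρnonneg : ∀ x y, 0 ≤ ρ x y) (hρposdef : ∀ x y, ρ x y = 0 ↔ x = y)
    {K L : Set E} (hK : IsCompact K) (hL : IsCompact L) (hd : Disjoint K L) :
    ∃ ε > 0, ∀ x ∈ K, ∀ y ∈ L, ε < ρ x y := by
  rcases (K ×ˢ L).eq_empty_or_nonempty with he | hne
  · refine ⟨1, one_pos, fun x hx y hy => ?_⟩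
    have : (x, y) ∈ K ×ˢ L := ⟨hx, hy⟩
    rw [he] at this
    exact this.elim
  · obtain ⟨p, hp, hmin⟩ := LowerSemicontinuousOn.exists_isMinOn hne (hK.prod hL)
      (hρlsc.lowerSemicontinuousOn _)
    have hpos : 0 < ρ p.1 p.2 := by
      refine lt_of_le_of_ne (hρnonneg _ _) fun h => ?_
      have := (hρposdef _ _).1 h.symm
      exact Set.disjoint_left.1 hd hp.1 (this ▸ hp.2)
    refine ⟨ρ p.1 p.2 / 2, by linarith, fun x hx y hy => ?_⟩
    have : ρ p.1 p.2 ≤ ρ x y := hmin (show (x, y) ∈ K ×ˢ L from ⟨hx, hy⟩)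
    linarith

lemma not_bad {B : Set E} {c : ℝ} {ω : ℕ → E} (h : ω ∉ bad B c) :
    ∃ k : ℕ, ∀ n : ℕ, ∑ i ∈ Finset.range n, B.indicator (1 : E → ℝ) (ω i) ≤ c * n + k := by
  have : ∃ k : ℕ, ∀ n : ℕ, ¬ ((k : ℝ) < ∑ i ∈ Finset.range n, (B.indicator 1 (ω i) - c)) := by
    by_contra hcon
    push Not at hcon
    exact h hcon
  obtain ⟨k, hk⟩ := this
  refine ⟨k, fun n => ?_⟩
  have := not_lt.1 (hk n)
  rw [Finset.sum_sub_distrib] at this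
  simp only [Finset.sum_const, Finset.card_range, nsmul_eq_mul] at this
  linarith

lemma limsup_lt {ρ : E → E → ℝ} {K L : Set E} {ε c α : ℝ} (hα : 2 * c < α)
    (hε : ∀ x ∈ K, ∀ y ∈ L, ε < ρ x y) {p : (ℕ → E) × (ℕ → E)}
    (h1 : p.1 ∉ bad Kᶜ c) (h2 : p.2 ∉ bad Lᶜ c) :
    ¬ (α ≤ limsup (fun n : ℕ =>
          (∑ i ∈ Finset.range n,
            if ρ (p.1 i) (p.2 i) ≤ ε then (1 : ℝ) else 0) / n) atTop) := by
  obtain ⟨k, hk⟩ := not_bad h1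
  obtain ⟨l, hl⟩ := not_bad h2
  rw [not_le]
  have hnn : ∀ n : ℕ, 0 ≤ (∑ i ∈ Finset.range n,
            if ρ (p.1 i) (p.2 i) ≤ ε then (1 : ℝ) else 0) / n := fun n => by
    refine div_nonneg (Finset.sum_nonneg fun i _ => ?_) n.cast_nonneg
    split_ifs <;> norm_num
  have hle : limsup (fun n : ℕ => (∑ i ∈ Finset.range n,
            if ρ (p.1 i) (p.2 i) ≤ ε then (1 : ℝ) else 0) / n) atTop ≤ (2 * c + α) / 2 := by
    refine limsup_le_of_le (IsBoundedUnder.isCoboundedUnder_le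
      ⟨0, eventually_map.2 (.of_forall hnn)⟩) ?_
    obtain ⟨N, hN⟩ := exists_nat_ge ((k + l : ℝ) / ((α - 2 * c) / 2))
    filter_upwards [eventually_ge_atTop N, eventually_gt_atTop 0] with n hn hn0
    have hn0' : (0 : ℝ) < n := by exact_mod_cast hn0
    rw [div_le_iff₀ hn0']
    have hsum : (∑ i ∈ Finset.range n, if ρ (p.1 i) (p.2 i) ≤ ε then (1 : ℝ) else 0) ≤
        ∑ i ∈ Finset.range n, Kᶜ.indicator (1 : E → ℝ) (p.1 i) +
        ∑ i ∈ Finset.range n, Lᶜ.indicator (1 : E → ℝ) (p.2 i) := by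
      rw [← Finset.sum_add_distrib]
      refine Finset.sum_le_sum fun i _ => ?_
      have a0 : 0 ≤ Kᶜ.indicator (1 : E → ℝ) (p.1 i) :=
        Set.indicator_nonneg (fun _ _ => zero_le_one) _
      have b0 : 0 ≤ Lᶜ.indicator (1 : E → ℝ) (p.2 i) :=
        Set.indicator_nonneg (fun _ _ => zero_le_one) _
      split_ifs with hi
      · by_cases hx : p.1 i ∈ K
        · have hy : p.2 i ∉ L := fun hy => absurd hi (not_le.2 (hε _ hx _ hy))
          rw [Set.indicator_of_mem (show p.2 i ∈ Lᶜ from hy)]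
          simpa using a0
        · rw [Set.indicator_of_mem (show p.1 i ∈ Kᶜ from hx)]
          simpa using b0
      · linarith
    have hpos : 0 < (α - 2 * c) / 2 := by linarith
    have hkl : (k + l : ℝ) ≤ n * ((α - 2 * c) / 2) := by
      rw [← div_le_iff₀ hpos]
      exact hN.trans (by exact_mod_cast hn)
    nlinarith [hk n, hl n]
  linarith

end GenCoup

/-- Corollary, Polish case: on a Polish space, with a lower semicontinuous
positive definite function `ρ : E × E → [0,∞)` in place of the metric, if there
is a Borel set `M` charged by every invariant probability measure such that
every pair of starting points in `M` admits generalized couplings keeping the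
trajectories `ρ`-`ε`-close with positive limiting frequency (with positive
probability), then the Markov kernel `P` has at most one invariant probability
measure. -/
theorem unique_invariant_measure_of_generalized_couplings_polish
    {E : Type*} [TopologicalSpace E] [PolishSpace E]
    [MeasurableSpace E] [BorelSpace E]
    (P : Kernel E E) [IsMarkovKernel P]
    (ℙP : E → Measure (ℕ → E)) (hℙ : IsChainLaw P ℙP)
    (ρ : E → E → ℝ) (hρlsc : LowerSemicontinuous (fun p : E × E => ρ p.1 p.2))
    (hρnonneg : ∀ x y, 0 ≤ ρ x y) (hρposdef : ∀ x y, ρ x y = 0 ↔ x = y)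
    (M : Set E) (hM : MeasurableSet M)
    (hMpos : ∀ μ : Measure E, IsProbabilityMeasure μ → IsInvariantMeasure P μ →
      0 < μ M)
    (hcoup : ∀ x ∈ M, ∀ y ∈ M, ∃ α > (0 : ℝ), ∀ ε > (0 : ℝ),
      ∃ ξ : Measure ((ℕ → E) × (ℕ → E)), IsGeneralizedCoupling ξ (ℙP x) (ℙP y) ∧
        0 < ξ {p : (ℕ → E) × (ℕ → E) | α ≤ limsup (fun n : ℕ =>
          (∑ i ∈ Finset.range n,
            if ρ (p.1 i) (p.2 i) ≤ ε then (1 : ℝ) else 0) / n) atTop}) :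
    ∀ μ ν : Measure E, IsProbabilityMeasure μ → IsProbabilityMeasure ν →
      IsInvariantMeasure P μ → IsInvariantMeasure P ν → μ = ν := by
  intro μ ν hμp hνp hμi hνi
  have hμ := GenCoup.invariant_iff.1 hμi
  have hν := GenCoup.invariant_iff.1 hνi
  have hinf := GenCoup.inf_invariant hμ hν
  have hfin : IsFiniteMeasure (μ ⊓ ν) := isFiniteMeasure_of_le μ inf_le_left
  have hμ' := GenCoup.sub_invariant (inf_le_left : μ ⊓ ν ≤ μ) hμ hinf
  have hν' := GenCoup.sub_invariant (inf_le_right : μ ⊓ ν ≤ ν) hν hinf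
  have hcμ := Measure.sub_add_cancel_of_le (inf_le_left : μ ⊓ ν ≤ μ)
  have hcν := Measure.sub_add_cancel_of_le (inf_le_right : μ ⊓ ν ≤ ν)
  have hsing := GenCoup.sub_inf_singular (μ := μ) (ν := ν)
  have f1 : IsFiniteMeasure (μ - μ ⊓ ν) := isFiniteMeasure_of_le μ Measure.sub_le
  have f2 : IsFiniteMeasure (ν - μ ⊓ ν) := isFiniteMeasure_of_le ν Measure.sub_le
  by_contra hne
  have hn1 : μ - μ ⊓ ν ≠ 0 := by
    intro h0
    rw [h0, zero_add] at hcμ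
    exact hne (Measure.eq_of_le_of_measure_univ_eq (inf_eq_left.1 hcμ) (by simp))
  have hn2 : ν - μ ⊓ ν ≠ 0 := by
    intro h0
    rw [h0, zero_add] at hcν
    exact hne (Measure.eq_of_le_of_measure_univ_eq (inf_eq_right.1 hcν) (by simp)).symm
  have hM1 := GenCoup.pos_of_ne_zero hMpos hμ' hn1
  have hM2 := GenCoup.pos_of_ne_zero hMpos hν' hn2
  obtain ⟨A, hA, hA1, hA2⟩ := hsing
  obtain ⟨K, hKA, hK, hKs⟩ := GenCoup.compacts (μ := μ - μ ⊓ ν) hA.compl (by rwa [compl_compl])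
  obtain ⟨L, hLA, hL, hLs⟩ := GenCoup.compacts (μ := ν - μ ⊓ ν) hA hA2
  have g1 := GenCoup.bad_eventually hℙ hμ' (fun n => (hK n).measurableSet.compl) hKs
  have g2 := GenCoup.bad_eventually hℙ hν' (fun n => (hL n).measurableSet.compl) hLs
  obtain ⟨x, hxM, hx⟩ := Frequently.exists
    ((frequently_ae_mem_iff.2 hM1).and_eventually g1)
  obtain ⟨y, hyM, hy⟩ := Frequently.exists
    ((frequently_ae_mem_iff.2 hM2).and_eventually g2)
  obtain ⟨α, hα, hξ⟩ := hcoup x hxM y hyM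
  obtain ⟨k, hk⟩ := exists_nat_one_div_lt (half_pos hα)
  obtain ⟨n, hnx, hny⟩ := ((hx k).and (hy k)).exists
  obtain ⟨ε, hε, hεKL⟩ := GenCoup.exists_eps hρlsc hρnonneg hρposdef (hK n) (hL n)
    (Set.disjoint_left.2 fun z hz hz' => hKA n hz (hLA n hz'))
  obtain ⟨ξ, ⟨-, hξ1, hξ2⟩, hpos⟩ := hξ ε hε
  refine hpos.ne' ?_
  have z1 := hξ1 hnx
  have z2 := hξ2 hny
  rw [Measure.map_apply measurable_fst
    (GenCoup.measurableSet_bad (hK n).measurableSet.compl _)] at z1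
  rw [Measure.map_apply measurable_snd
    (GenCoup.measurableSet_bad (hL n).measurableSet.compl _)] at z2
  refine measure_mono_null ?_ (measure_union_null z1 z2)
  intro p hp
  by_contra hcon
  rw [Set.mem_union, not_or] at hcon
  exact GenCoup.limsup_lt (by linarith) hεKL hcon.1 hcon.2 hp
end

section
/- There exist a separable metric space (E, d), a continuous positive definite function ρ : E × E → [0, ∞) (ρ(x,y) = 0 iff x = y), and a Markov kernel P on E (with Borel σ-field induced by d) such that: (i) P admits two mutually singular invariant probability measures; (ii) for every pair x, y ∈ E there exists a true coupling ξ_{x,y} ∈ 𝓒(ℙ_x, ℙ_y) under which the two coupled chains (X_n, Y_n) satisfy ρ(X_n, Y_n) → 0 almost surely; and (iii) P is strong Feller, i.e. x ↦ ∫ f(y) P(x, dy) is continuous for every bounded measurable f : E → ℝ. -/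
open MeasureTheory ProbabilityTheory Filter

/-! ### A two-colouring of the line with both colours of full outer measure -/

theorem exists_colour : ∃ c : ℝ → Bool, ∀ b : Bool, ∀ T : Set ℝ, MeasurableSet T →
    (∀ x ∈ T, c x = b) → volume T = 0 := by
  obtain ⟨f, hf⟩ := (Algebra.linearMap ℚ ℝ).exists_leftInverse_of_injective
    (LinearMap.ker_eq_bot.2 (algebraMap ℚ ℝ).injective)
  have hfq : ∀ q : ℚ, f (q : ℝ) = q := fun q => by
    simpa using LinearMap.congr_fun hf q
  set z : ℝ := Real.sqrt 2 - (f (Real.sqrt 2) : ℚ) with hz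
  have hfz : f z = 0 := by rw [hz, map_sub, hfq, sub_self]
  have hz0 : z ≠ 0 := by
    intro h
    exact irrational_sqrt_two ⟨f (Real.sqrt 2), by linarith⟩
  have small : ∀ ε > 0, ∃ w : ℝ, |w| < ε ∧ f w = 1 := by
    intro ε hε
    have hz' : 0 < |z| := abs_pos.2 hz0
    obtain ⟨t, ht1, ht2⟩ := exists_rat_btwn (show -1 / z < -1 / z + ε / |z| by
      have := div_pos hε hz'; linarith)
    refine ⟨1 + t * z, ?_, ?_⟩
    · have e : 1 + t * z = ((t : ℝ) - (-1 / z)) * z := by field_simp; ring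
      rw [e, abs_mul, abs_of_pos (by linarith)]
      calc ((t : ℝ) - (-1 / z)) * |z| < (ε / |z|) * |z| := by
            apply mul_lt_mul_of_pos_right _ hz'; linarith
        _ = ε := by field_simp
    · have h1 : f 1 = 1 := by simpa using hfq 1
      have h2 : (t : ℝ) * z = t • z := (Rat.smul_def t z).symm
      rw [map_add, h1, h2, map_smul, hfz]; simp
  refine ⟨fun x => decide (Even ⌊f x⌋), fun b T hT hb => ?_⟩
  by_contra hpos
  have hnh := Measure.sub_mem_nhds_zero_of_addHaar_pos volume T hT (pos_iff_ne_zero.2 hpos)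
  obtain ⟨ε, hε, hball⟩ := Metric.mem_nhds_iff.1 hnh
  obtain ⟨w, hw, hfw⟩ := small ε hε
  obtain ⟨x, hx, y, hy, hxy⟩ := hball (show w ∈ Metric.ball 0 ε by simpa using hw)
  have hx' : f x = f y + 1 := by
    have : x = y + w := by simp only at hxy; linarith
    rw [this, map_add, hfw]
  have h1 := hb x hx
  have h2 := hb y hy
  simp only [hx', Int.floor_add_one, Int.even_add_one] at h1
  rw [← h2] at h1
  simp only [decide_eq_decide] at h1
  tauto

/-! ### Product measures and prepending -/

section Gen

variable {E : Type*} [MeasurableSpace E]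

theorem measurable_consTraj_uncurry :
    Measurable (fun p : E × (ℕ → E) => consTraj p.1 p.2) := by
  refine measurable_pi_lambda _ fun n => ?_
  cases n with
  | zero => exact measurable_fst
  | succ n => exact (measurable_pi_apply n).comp measurable_snd

theorem measurable_consTraj (x : E) : Measurable (consTraj x) :=
  measurable_consTraj_uncurry.comp measurable_prodMk_left

theorem infinitePi_cons (m : Measure E) [IsProbabilityMeasure m] :
    (m.prod (Measure.infinitePi (fun _ : ℕ => m))).map (fun p => consTraj p.1 p.2)
      = Measure.infinitePi (fun _ : ℕ => m) := by
  classical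
  apply Measure.eq_infinitePi
  intro s t ht
  rw [Measure.map_apply measurable_consTraj_uncurry
    (MeasurableSet.pi s.countable_toSet fun i _ => ht i)]
  have e : (fun p : E × (ℕ → E) => consTraj p.1 p.2) ⁻¹' (Set.pi s t)
      = (if 0 ∈ s then t 0 else Set.univ) ×ˢ
        Set.pi (s.preimage Nat.succ Nat.succ_injective.injOn : Finset ℕ)
          (fun n => t (n + 1)) := by
    ext ⟨y, ω⟩
    simp only [Set.mem_preimage, Set.mem_pi, Set.mem_prod, Finset.mem_coe, Finset.mem_preimage]
    constructor
    · intro h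
      refine ⟨?_, fun i hi => h _ hi⟩
      split_ifs with h0
      · exact h 0 h0
      · trivial
    · rintro ⟨h1, h2⟩ i hi
      cases i with
      | zero =>
        rw [if_pos hi] at h1
        exact h1
      | succ i => exact h2 i hi
  have hp : ∏ i ∈ s.preimage Nat.succ Nat.succ_injective.injOn, m (t (i + 1))
      = ∏ n ∈ s with n ≠ 0, m (t n) := by
    refine (Finset.prod_preimage' Nat.succ s Nat.succ_injective.injOn (fun n => m (t n))).trans ?_
    refine Finset.prod_congr (Finset.filter_congr fun n _ => ?_) fun _ _ => rfl
    simp [Nat.pos_iff_ne_zero]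
  rw [e, Measure.prod_prod, Measure.infinitePi_pi _ (fun i _ => ht _), hp]
  split_ifs with h0
  · rw [Finset.filter_ne', Finset.mul_prod_erase s (fun n => m (t n)) h0]
  · rw [measure_univ, one_mul, Finset.filter_true_of_mem]
    rintro x hx rfl; exact h0 hx

/-- Law of the chain started at `x` and then i.i.d. with law `m`. -/
noncomputable def iidLaw (m : Measure E) [IsProbabilityMeasure m] (x : E) : Measure (ℕ → E) :=
  (Measure.infinitePi (fun _ : ℕ => m)).map (consTraj x)

instance (m : Measure E) [IsProbabilityMeasure m] (x : E) : IsProbabilityMeasure (iidLaw m x) :=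
  Measure.isProbabilityMeasure_map (measurable_consTraj x).aemeasurable

theorem iidLaw_bind (m : Measure E) [IsProbabilityMeasure m] (x : E) :
    iidLaw m x = m.bind (fun y => (iidLaw m y).map (consTraj x)) := by
  have key : Measurable (fun p : E × (ℕ → E) => consTraj x (consTraj p.1 p.2)) :=
    (measurable_consTraj x).comp measurable_consTraj_uncurry
  have ev : ∀ S : Set (ℕ → E), MeasurableSet S → ∀ y, (iidLaw m y).map (consTraj x) S
      = Measure.infinitePi (fun _ : ℕ => m) (Prod.mk y ⁻¹'
        ((fun p : E × (ℕ → E) => consTraj x (consTraj p.1 p.2)) ⁻¹' S)) := by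
    intro S hS y
    rw [Measure.map_apply (measurable_consTraj x) hS, iidLaw,
      Measure.map_apply (measurable_consTraj y) (measurable_consTraj x hS)]
    rfl
  have meas : Measurable (fun y => (iidLaw m y).map (consTraj x)) := by
    refine Measure.measurable_of_measurable_coe _ fun S hS => ?_
    simp_rw [ev S hS]
    exact measurable_measure_prodMk_left (key hS)
  ext S hS
  rw [Measure.bind_apply hS meas.aemeasurable]
  simp_rw [ev S hS]
  rw [← Measure.prod_apply (key hS), iidLaw, Measure.map_apply (measurable_consTraj x) hS]
  conv_lhs => rw [← infinitePi_cons m]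
  rw [Measure.map_apply measurable_consTraj_uncurry (measurable_consTraj x hS)]
  rfl

/-! ### Couplings of measures with the same image on the line -/

/-- The coupling which is a conditional product on each cell `q = k`. -/
noncomputable def cellCoupling (m m' : Measure E) (q : E → ℤ) : Measure (E × E) :=
  Measure.sum fun k : ℤ =>
    (m (q ⁻¹' {k}))⁻¹ • (m.restrict (q ⁻¹' {k})).prod (m'.restrict (q ⁻¹' {k}))

theorem sum_restrict_cells (m : Measure E) (q : E → ℤ) (hq : Measurable q) :
    Measure.sum (fun k : ℤ => m.restrict (q ⁻¹' {k})) = m := by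
  rw [← Measure.restrict_iUnion]
  · have : (⋃ k : ℤ, q ⁻¹' {k}) = Set.univ := by ext x; simp
    rw [this, Measure.restrict_univ]
  · intro i j hij
    rw [Function.onFun, Set.disjoint_left]
    rintro x rfl h
    exact hij h
  · exact fun k => hq (measurableSet_singleton k)

theorem cellCoupling_fst (m m' : Measure E) [IsProbabilityMeasure m] [IsProbabilityMeasure m']
    (q : E → ℤ) (hq : Measurable q) (h : ∀ k, m (q ⁻¹' {k}) = m' (q ⁻¹' {k})) :
    (cellCoupling m m' q).map Prod.fst = m := by
  rw [cellCoupling, Measure.map_sum measurable_fst.aemeasurable]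
  conv_rhs => rw [← sum_restrict_cells m q hq]
  congr 1
  ext1 k
  rw [Measure.map_smul, Measure.map_fst_prod, Measure.restrict_apply_univ, ← h k]
  by_cases h0 : m (q ⁻¹' {k}) = 0
  · rw [Measure.restrict_eq_zero.2 h0]; simp
  · rw [smul_smul, ENNReal.inv_mul_cancel h0 (measure_ne_top _ _), one_smul]

theorem cellCoupling_snd (m m' : Measure E) [IsProbabilityMeasure m] [IsProbabilityMeasure m']
    (q : E → ℤ) (hq : Measurable q) (h : ∀ k, m (q ⁻¹' {k}) = m' (q ⁻¹' {k})) :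
    (cellCoupling m m' q).map Prod.snd = m' := by
  rw [cellCoupling, Measure.map_sum measurable_snd.aemeasurable]
  conv_rhs => rw [← sum_restrict_cells m' q hq]
  congr 1
  ext1 k
  rw [Measure.map_smul, Measure.map_snd_prod, Measure.restrict_apply_univ]
  by_cases h0 : m (q ⁻¹' {k}) = 0
  · rw [Measure.restrict_eq_zero.2 (h k ▸ h0)]; simp
  · rw [smul_smul, ENNReal.inv_mul_cancel h0 (measure_ne_top _ _), one_smul]

theorem cellCoupling_ae (m m' : Measure E) [IsProbabilityMeasure m] [IsProbabilityMeasure m']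
    (q : E → ℤ) (hq : Measurable q) : ∀ᵐ p ∂(cellCoupling m m' q), q p.1 = q p.2 := by
  have hset : MeasurableSet {p : E × E | q p.1 = q p.2} :=
    measurableSet_eq_fun (hq.comp measurable_fst) (hq.comp measurable_snd)
  rw [cellCoupling, Measure.ae_sum_iff' hset]
  intro k
  refine Measure.ae_smul_measure ?_ _
  rw [Measure.prod_restrict]
  filter_upwards [ae_restrict_mem ((hq (measurableSet_singleton k)).prod
    (hq (measurableSet_singleton k)))] with p hp
  exact hp.1.trans hp.2.symm

theorem exists_coupling (pr : E → ℝ) (hpr : Measurable pr) (m m' : Measure E)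
    [IsProbabilityMeasure m] [IsProbabilityMeasure m'] (hm : m.map pr = m'.map pr) (x y : E) :
    ∃ ξ : Measure ((ℕ → E) × (ℕ → E)), IsProbabilityMeasure ξ ∧
      ξ.map Prod.fst = iidLaw m x ∧ ξ.map Prod.snd = iidLaw m' y ∧
      ∀ᵐ p ∂ξ, Tendsto (fun n : ℕ => |pr (p.1 n) - pr (p.2 n)|) atTop (nhds 0) := by
  let q : ℕ → E → ℤ := fun n e => ⌊((n : ℝ) + 1) * pr e⌋
  have hq : ∀ n, Measurable (q n) := fun n => (hpr.const_mul _).floor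
  have hqm : ∀ n k, m (q n ⁻¹' {k}) = m' (q n ⁻¹' {k}) := by
    intro n k
    have hS : MeasurableSet ((fun r : ℝ => ⌊((n : ℝ) + 1) * r⌋) ⁻¹' {k}) :=
      (measurable_id.const_mul ((n : ℝ) + 1)).floor (measurableSet_singleton k)
    have := congrArg (fun μ : Measure ℝ => μ ((fun r : ℝ => ⌊((n : ℝ) + 1) * r⌋) ⁻¹' {k})) hm
    simp only [Measure.map_apply hpr hS] at this
    exact this
  let κ : ℕ → Measure (E × E) := fun n => cellCoupling m m' (q n)
  have hκ1 : ∀ n, (κ n).map Prod.fst = m := fun n => cellCoupling_fst m m' _ (hq n) (hqm n)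
  have hκ2 : ∀ n, (κ n).map Prod.snd = m' := fun n => cellCoupling_snd m m' _ (hq n) (hqm n)
  have hκp : ∀ n, IsProbabilityMeasure (κ n) := fun n => by
    constructor
    have : (κ n).map Prod.fst Set.univ = 1 := by rw [hκ1 n, measure_univ]
    rwa [Measure.map_apply measurable_fst MeasurableSet.univ] at this
  have hae : ∀ᵐ ω ∂(Measure.infinitePi κ), ∀ n, q n (ω n).1 = q n (ω n).2 := by
    rw [ae_all_iff]
    intro n
    have h1 := cellCoupling_ae m m' (q n) (hq n)
    exact (measurePreserving_eval_infinitePi κ n).quasiMeasurePreserving.ae h1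
  have m1 : Measurable (fun ω : ℕ → E × E => fun n => (ω n).1) := by fun_prop
  have m2 : Measurable (fun ω : ℕ → E × E => fun n => (ω n).2) := by fun_prop
  let G : (ℕ → E × E) → (ℕ → E) × (ℕ → E) := fun ω =>
    (consTraj x (fun n => (ω n).1), consTraj y (fun n => (ω n).2))
  have hG : Measurable G :=
    ((measurable_consTraj x).comp m1).prodMk ((measurable_consTraj y).comp m2)
  refine ⟨(Measure.infinitePi κ).map G, Measure.isProbabilityMeasure_map hG.aemeasurable,
    ?_, ?_, ?_⟩
  · have := Measure.infinitePi_map_pi κ (f := fun _ => Prod.fst) (fun _ => measurable_fst)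
    rw [Measure.map_map measurable_fst hG, iidLaw]
    simp_rw [hκ1] at this
    rw [← this, Measure.map_map (measurable_consTraj x) m1]
    rfl
  · have := Measure.infinitePi_map_pi κ (f := fun _ => Prod.snd) (fun _ => measurable_snd)
    rw [Measure.map_map measurable_snd hG, iidLaw]
    simp_rw [hκ2] at this
    rw [← this, Measure.map_map (measurable_consTraj y) m2]
    rfl
  · rw [ae_map_iff hG.aemeasurable]
    · filter_upwards [hae] with ω hω
      rw [← tendsto_add_atTop_iff_nat 1]
      refine squeeze_zero (fun n => abs_nonneg _) (fun n => ?_)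
        tendsto_one_div_add_atTop_nhds_zero_nat
      have h1 := Int.abs_sub_lt_one_of_floor_eq_floor (hω n)
      change |pr (ω n).1 - pr (ω n).2| ≤ _
      have hn : (0 : ℝ) < (n : ℝ) + 1 := by positivity
      rw [← mul_sub, abs_mul, abs_of_pos hn] at h1
      rw [le_div_iff₀ hn]
      linarith
    · have : Measurable fun p : (ℕ → E) × (ℕ → E) => fun n => |pr (p.1 n) - pr (p.2 n)| := by
        refine measurable_pi_lambda _ fun n => ?_
        exact continuous_abs.measurable.comp
          ((hpr.comp ((measurable_pi_apply n).comp measurable_fst)).sub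
          (hpr.comp ((measurable_pi_apply n).comp measurable_snd)))
      exact measurableSet_tendsto (nhds 0) fun n => (measurable_pi_apply n).comp this

end Gen

/-! ### The state space -/

/-- The graph of the colouring. -/
abbrev ColourSpace (c : ℝ → Bool) : Type := {p : ℝ × ℤ // p.2 = if c p.1 then 1 else 0}

/-- Trace of Lebesgue measure on the part of colour `b`. -/
theorem exists_trace (c : ℝ → Bool) (hc : ∀ b : Bool, ∀ T : Set ℝ, MeasurableSet T →
    (∀ x ∈ T, c x = b) → volume T = 0) [MeasurableSpace (ColourSpace c)]
    [BorelSpace (ColourSpace c)] (b : Bool) :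
    ∃ m : Measure (ColourSpace c),
      m.map (fun p => p.1.1) = volume.restrict (Set.Icc (0 : ℝ) 1) ∧
      ∀ᵐ p ∂m, c p.1.1 = b := by
  set μ0 : Measure ℝ := volume.restrict (Set.Icc (0 : ℝ) 1) with hμ0
  let pr : ColourSpace c → ℝ := fun p => p.1.1
  have hpr : Measurable pr := (continuous_fst.comp continuous_subtype_val).measurable
  have hinj : Function.Injective pr := by
    rintro ⟨⟨x, i⟩, hx⟩ ⟨⟨y, j⟩, hy⟩ h
    simp only [pr] at h
    simp only at hx hy
    subst h
    simp [hx, hy]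
  let O : OuterMeasure (ColourSpace c) :=
    OuterMeasure.comap pr (OuterMeasure.restrict {x | c x = b} μ0.toOuterMeasure)
  have hO : ∀ S, O S = μ0 (pr '' S ∩ {x | c x = b}) := fun S => by
    simp only [O, OuterMeasure.comap_apply, OuterMeasure.restrict_apply,
      Measure.coe_toOuterMeasure]
  have hcar : ‹MeasurableSpace (ColourSpace c)› ≤ O.caratheodory := by
    intro S hS
    have hS' : @MeasurableSet _ (MeasurableSpace.comap Subtype.val
        (inferInstance : MeasurableSpace (ℝ × ℤ))) S := by
      have e1 : ‹MeasurableSpace (ColourSpace c)› = borel _ := BorelSpace.measurable_eq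
      have e2 : (Subtype.instMeasurableSpace : MeasurableSpace (ColourSpace c)) = borel _ :=
        (Subtype.borelSpace _).measurable_eq
      have e3 := e1.trans e2.symm
      rw [e3] at hS
      exact hS
    obtain ⟨T, hT, rfl⟩ := hS'
    rw [OuterMeasure.isCaratheodory_iff]
    intro R
    rw [hO, hO, hO]
    let Tb : Set ℝ := (fun x : ℝ => (x, if b then (1 : ℤ) else 0)) ⁻¹' T
    have hTb : MeasurableSet Tb := measurable_prodMk_right hT
    rw [← measure_inter_add_sdiff (pr '' R ∩ {x | c x = b}) hTb]
    have hmem : ∀ p : ColourSpace c, c (pr p) = b → (pr p ∈ Tb ↔ p.1 ∈ T) := by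
      rintro ⟨⟨x, i⟩, hx⟩ hb
      have hx' : i = if c x then 1 else 0 := hx
      have hb' : c x = b := hb
      change (x, if b then (1 : ℤ) else 0) ∈ T ↔ (x, i) ∈ T
      rw [hx', hb']
    congr 2
    · ext x
      constructor
      · rintro ⟨⟨⟨p, hp, rfl⟩, hb⟩, hx⟩
        exact ⟨⟨p, ⟨hp, (hmem p hb).1 hx⟩, rfl⟩, hb⟩
      · rintro ⟨⟨p, ⟨hp, hpT⟩, rfl⟩, hb⟩
        exact ⟨⟨⟨p, hp, rfl⟩, hb⟩, (hmem p hb).2 hpT⟩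
    · ext x
      constructor
      · rintro ⟨⟨⟨p, hp, rfl⟩, hb⟩, hx⟩
        exact ⟨⟨p, ⟨hp, fun h => hx ((hmem p hb).2 h)⟩, rfl⟩, hb⟩
      · rintro ⟨⟨p, ⟨hp, hpT⟩, rfl⟩, hb⟩
        exact ⟨⟨⟨p, hp, rfl⟩, hb⟩, fun h => hpT ((hmem p hb).1 h)⟩
  have hcol : MeasurableSet {p : ColourSpace c | ¬ c p.1.1 = b} := by
    have : {p : ColourSpace c | ¬ c p.1.1 = b}
        = (fun p : ColourSpace c => p.1.2) ⁻¹' {if b then 0 else 1} := by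
      ext ⟨⟨x, i⟩, hx⟩
      have hx' : i = if c x then 1 else 0 := hx
      cases b <;> cases h : c x <;> simp [h, hx']
    rw [this]
    exact (continuous_snd.comp continuous_subtype_val).measurable (measurableSet_singleton _)
  refine ⟨O.toMeasure hcar, ?_, ?_⟩
  · ext T hT
    rw [Measure.map_apply hpr hT, toMeasure_apply _ _ (hpr hT), hO]
    have hsurj : Function.Surjective pr := fun x => ⟨⟨(x, if c x then 1 else 0), rfl⟩, rfl⟩
    rw [Set.image_preimage_eq _ hsurj]
    refine le_antisymm (measure_mono Set.inter_subset_left) ?_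
    set H := toMeasurable μ0 (T ∩ {x | c x = b}) with hH
    have hHm : MeasurableSet H := measurableSet_toMeasurable _ _
    have h0 : volume (T \ H) = 0 := by
      refine hc (!b) _ (hT.diff hHm) fun x hx => ?_
      have : c x ≠ b := fun h => hx.2 (subset_toMeasurable _ _ ⟨hx.1, h⟩)
      cases b <;> cases h : c x <;> simp_all
    have h0' : μ0 (T \ H) = 0 := Measure.absolutelyContinuous_of_le Measure.restrict_le_self h0
    calc μ0 T ≤ μ0 (H ∪ T \ H) := measure_mono (by intro x hx; by_cases h : x ∈ H <;> simp [h, hx])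
      _ ≤ μ0 H + μ0 (T \ H) := measure_union_le _ _
      _ = μ0 (T ∩ {x | c x = b}) := by rw [h0', add_zero, hH, measure_toMeasurable]
  · rw [ae_iff, toMeasure_apply _ _ hcol, hO]
    have : pr '' {p : ColourSpace c | ¬ c p.1.1 = b} ∩ {x | c x = b} = ∅ := by
      ext x
      simp only [Set.mem_inter_iff, Set.mem_empty_iff_false, iff_false]
      rintro ⟨⟨p, hp, rfl⟩, h⟩
      exact hp h
    rw [this, measure_empty]

/-- There exist a separable metric space `E`, a continuous positive definite
function `ρ : E × E → [0,∞)`, and a Markov kernel `P` on `E` (with the Borel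
σ-field of the metric) such that: (i) `P` admits two mutually singular
invariant probability measures; (ii) for every `x, y ∈ E` there is a true
coupling of `ℙ_x` and `ℙ_y` under which `ρ(X_n, Y_n) → 0` almost surely; and
(iii) `P` is strong Feller. -/
theorem exists_counterexample_separable_metric :
    ∃ (E : Type) (m : MetricSpace E),
      letI := m
      TopologicalSpace.SeparableSpace E ∧
      ∃ ρ : E → E → ℝ,
        Continuous (fun p : E × E => ρ p.1 p.2) ∧
        (∀ x y, 0 ≤ ρ x y) ∧ (∀ x y, ρ x y = 0 ↔ x = y) ∧
        (letI : MeasurableSpace E := borel E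
         letI : BorelSpace E := ⟨rfl⟩
         ∃ P : Kernel E E, IsMarkovKernel P ∧
          ∃ ℙP : E → Measure (ℕ → E), IsChainLaw P ℙP ∧
            (∃ μ ν : Measure E, IsProbabilityMeasure μ ∧ IsProbabilityMeasure ν ∧
              IsInvariantMeasure P μ ∧ IsInvariantMeasure P ν ∧
              ∃ C : Set E, MeasurableSet C ∧ μ C = 1 ∧ ν C = 0) ∧
            (∀ x y : E, ∃ ξ : Measure ((ℕ → E) × (ℕ → E)),
              IsProbabilityMeasure ξ ∧
              ξ.map Prod.fst = ℙP x ∧ ξ.map Prod.snd = ℙP y ∧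
              ∀ᵐ p ∂ξ, Tendsto (fun n : ℕ => ρ (p.1 n) (p.2 n)) atTop (nhds 0)) ∧
            (∀ f : E → ℝ, Measurable f → (∃ Cf : ℝ, ∀ x, |f x| ≤ Cf) →
              Continuous fun x => ∫ y, f y ∂(P x))) := by
  obtain ⟨c, hc⟩ := exists_colour
  refine ⟨ColourSpace c, inferInstance, inferInstance, fun p q => |p.1.1 - q.1.1|, ?_, ?_, ?_, ?_⟩
  · fun_prop
  · exact fun _ _ => abs_nonneg _
  · rintro ⟨⟨x, i⟩, hx⟩ ⟨⟨y, j⟩, hy⟩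
    simp only at hx hy
    rw [abs_eq_zero, sub_eq_zero]
    constructor
    · intro h
      simp only at h
      subst h
      simp [hx, hy]
    · intro h
      rw [h]
  letI : MeasurableSpace (ColourSpace c) := borel (ColourSpace c)
  letI : BorelSpace (ColourSpace c) := ⟨rfl⟩
  choose m hm hmb using exists_trace c hc
  have hpr : Measurable (fun p : ColourSpace c => p.1.1) :=
    (continuous_fst.comp continuous_subtype_val).measurable
  have hmp : ∀ b, IsProbabilityMeasure (m b) := fun b => by
    constructor
    have : (m b).map (fun p => p.1.1) Set.univ = 1 := by rw [hm b]; simp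
    rwa [Measure.map_apply hpr MeasurableSet.univ] at this
  let s : ColourSpace c → Bool := fun p => c p.1.1
  have hs : Continuous s := by
    have : s = fun p => decide (p.1.2 = 1) := by
      funext ⟨⟨x, i⟩, hx⟩
      have hx' : i = if c x then 1 else 0 := hx
      cases h : c x <;> simp [s, h, hx']
    rw [this]
    exact (continuous_of_discreteTopology (f := fun i : ℤ => decide (i = 1))).comp
      (continuous_snd.comp continuous_subtype_val)
  have hsm : Measurable s := hs.measurable
  let P : Kernel (ColourSpace c) (ColourSpace c) :=
    ⟨fun x => m (s x), (measurable_of_countable m).comp hsm⟩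
  have hP : ∀ x, P x = m (s x) := fun _ => rfl
  have hinv : ∀ b, IsInvariantMeasure P (m b) := by
    intro b A hA
    have : ∫⁻ x, P x A ∂(m b) = ∫⁻ _, m b A ∂(m b) := by
      refine lintegral_congr_ae ?_
      filter_upwards [hmb b] with x hx
      rw [hP, show s x = b from hx]
    rw [this, lintegral_const, measure_univ, mul_one]
  refine ⟨P, ⟨fun x => hmp (s x)⟩, fun x => iidLaw (m (s x)) x, ⟨fun x => inferInstance, ?_⟩,
    ⟨m true, m false, hmp _, hmp _, hinv _, hinv _, s ⁻¹' {true},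
      hsm (measurableSet_singleton _), ?_, ?_⟩, ?_, ?_⟩
  · intro x
    refine (iidLaw_bind (m (s x)) x).trans ?_
    rw [hP]
    refine Measure.bind_congr_right ?_
    filter_upwards [hmb (s x)] with y hy
    have hy' : s y = s x := hy
    simp only [hy']
  · exact (prob_compl_eq_zero_iff (hsm (measurableSet_singleton _))).1 (hmb true)
  · refine measure_mono_null (fun x hx => ?_) (ae_iff.1 (hmb false))
    have hx' : c x.1.1 = true := hx
    simp [hx']
  · intro x y
    exact exists_coupling _ hpr (m (s x)) (m (s y)) ((hm _).trans (hm _).symm) x y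
  · intro f _ _
    exact (continuous_of_discreteTopology (f := fun b : Bool => ∫ y, f y ∂(m b))).comp hs
end
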